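/- Let 0 → U → E → V → 0 be a short exact sequence of left R-modules in which U and V are simple R-modules and V is infinite-dimensional as a k-vector space. Then the sequence splits; that is, E is isomorphic to U ⊕ V as a left R-module, with the image of U a direct summand of E. -/

import Mathlib

/-!
`R = k⟨x,y⟩/⟨yx − 1⟩` is the associative `k`-algebra generated by `x` and `y`
with the single defining relation `y * x = 1` (the one-sided inverse of `k[x]`).
We realize it as the `RingQuot` of the free algebra on two generators.
-/

noncomputable section

/-- The defining relation `y * x = 1` on the free algebra `k⟨x,y⟩`. -/
inductive PreRel (k : Type) [Field k] : FreeAlgebra k (Fin 2) → FreeAlgebra k (Fin 2) → Prop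
  | yx : PreRel k (FreeAlgebra.ι k 1 * FreeAlgebra.ι k 0) 1

/-- `R = k⟨x,y⟩/⟨yx − 1⟩`. -/
abbrev R (k : Type) [Field k] := RingQuot (PreRel k)

/-- The generator `x` of `R`. -/
def Xg (k : Type) [Field k] : R k := RingQuot.mkAlgHom k (PreRel k) (FreeAlgebra.ι k 0)

/-- The generator `y` of `R`. -/
def Yg (k : Type) [Field k] : R k := RingQuot.mkAlgHom k (PreRel k) (FreeAlgebra.ι k 1)

open Polynomial

lemma yx_one (k : Type) [Field k] : Yg k * Xg k = 1 := by
  have h := RingQuot.mkAlgHom_rel k (PreRel.yx (k := k))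
  rw [map_mul, map_one] at h
  exact h

/-- Induction principle for `R`. -/
lemma R_induction (k : Type) [Field k] {C : R k → Prop}
    (hc : ∀ c : k, C (algebraMap k (R k) c)) (hx : C (Xg k)) (hy : C (Yg k))
    (hadd : ∀ a b, C a → C b → C (a + b)) (hmul : ∀ a b, C a → C b → C (a * b)) (r : R k) :
    C r := by
  obtain ⟨a, rfl⟩ := RingQuot.mkAlgHom_surjective k (PreRel k) r
  induction a using FreeAlgebra.induction with
  | grade0 c => rw [AlgHom.commutes]; exact hc c
  | grade1 i => fin_cases i
                · exact hx
                · exact hy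
  | mul a b ha hb => rw [map_mul]; exact hmul _ _ ha hb
  | add a b ha hb => rw [map_add]; exact hadd _ _ ha hb

lemma y_aeval (k : Type) [Field k] (p : k[X]) :
    Yg k * aeval (Xg k) p = aeval (Xg k) p.divX + algebraMap k (R k) (p.coeff 0) * Yg k := by
  conv_lhs => rw [← Polynomial.X_mul_divX_add p]
  rw [map_add, map_mul, aeval_X, aeval_C, mul_add, ← mul_assoc, yx_one, one_mul,
    Algebra.commutes]

section
variable (k : Type) [Field k] {M : Type} [AddCommGroup M] [Module (R k) M]

/-- Everything in `R v` is a polynomial in `x` applied to `v`, if `y v = 0`. -/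
lemma cyc_poly (v : M) (hv : Yg k • v = 0) (r : R k) :
    ∀ p : k[X], ∃ q : k[X], r • (aeval (Xg k) p) • v = (aeval (Xg k) q) • v := by
  induction r using R_induction with
  | hc c => intro p; exact ⟨C c * p, by rw [map_mul, aeval_C, mul_smul]⟩
  | hx => intro p; exact ⟨X * p, by rw [map_mul, aeval_X, mul_smul]⟩
  | hy => intro p
          refine ⟨p.divX, ?_⟩
          rw [← mul_smul, y_aeval, add_smul, mul_smul, hv, smul_zero, add_zero]
  | hadd a b ha hb =>
    intro p
    obtain ⟨q, hq⟩ := ha p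
    obtain ⟨q', hq'⟩ := hb p
    exact ⟨q + q', by rw [map_add, add_smul, add_smul, hq, hq']⟩
  | hmul a b ha hb =>
    intro p
    obtain ⟨q, hq⟩ := hb p
    obtain ⟨q', hq'⟩ := ha q
    exact ⟨q', by rw [mul_smul, hq, hq']⟩

lemma scalar_zero (v : M) (h0 : v ≠ 0) (c : k) (h : algebraMap k (R k) c • v = 0) : c = 0 := by
  by_contra hc
  apply h0
  have : algebraMap k (R k) c⁻¹ • algebraMap k (R k) c • v = 0 := by rw [h, smul_zero]
  rwa [← mul_smul, ← map_mul, inv_mul_cancel₀ hc, map_one, one_smul] at this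

lemma poly_indep (v : M) (hv : Yg k • v = 0) (h0 : v ≠ 0) (n : ℕ) :
    ∀ p : k[X], p.natDegree ≤ n → aeval (Xg k) p • v = 0 → p = 0 := by
  induction n with
  | zero =>
    intro p hp h
    rw [Polynomial.eq_C_of_natDegree_le_zero hp, aeval_C] at h
    rw [Polynomial.eq_C_of_natDegree_le_zero hp, scalar_zero k v h0 _ h, C_0]
  | succ n ih =>
    intro p hp h
    have h1 : p.divX = 0 := by
      apply ih
      · rw [Polynomial.natDegree_divX_eq_natDegree_tsub_one]; omega
      · have h2 : Yg k • aeval (Xg k) p • v = 0 := by rw [h, smul_zero]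
        rwa [← mul_smul, y_aeval, add_smul, mul_smul, hv, smul_zero, add_zero] at h2
    have h3 := Polynomial.X_mul_divX_add p
    rw [h1, mul_zero, zero_add] at h3
    rw [← h3, aeval_C] at h
    rw [← h3, scalar_zero k v h0 _ h, C_0]

/-- If `x y` acts as the identity, every `r` is `x^{-n} p(x)`. -/
lemma laurent (hxy : ∀ v : M, Xg k • Yg k • v = v) (r : R k) :
    ∃ (n : ℕ) (p : k[X]), ∀ v : M, (Xg k) ^ n • r • v = aeval (Xg k) p • v := by
  induction r using R_induction with
  | hc c => exact ⟨0, C c, fun v => by rw [aeval_C, pow_zero, one_smul]⟩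
  | hx => exact ⟨0, X, fun v => by rw [aeval_X, pow_zero, one_smul]⟩
  | hy => exact ⟨1, 1, fun v => by rw [map_one, pow_one, one_smul, hxy]⟩
  | hadd a b ha hb =>
    obtain ⟨n, p, hp⟩ := ha
    obtain ⟨m, q, hq⟩ := hb
    refine ⟨n + m, X ^ m * p + X ^ n * q, fun v => ?_⟩
    rw [map_add, map_mul, map_mul, map_pow, map_pow, aeval_X, add_smul, add_smul, mul_smul,
      mul_smul, ← hp, ← hq, ← mul_smul, ← mul_smul (Xg k ^ n), ← pow_add, ← pow_add, smul_add,
      add_comm m n]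
  | hmul a b ha hb =>
    obtain ⟨n, p, hp⟩ := ha
    obtain ⟨m, q, hq⟩ := hb
    refine ⟨m + n, p * q, fun v => ?_⟩
    have hcomm : Xg k ^ m * aeval (Xg k) p = aeval (Xg k) p * Xg k ^ m := by
      have : (X ^ m * p : k[X]) = p * X ^ m := mul_comm _ _
      simpa using congrArg (aeval (Xg k)) this
    rw [mul_smul a b, pow_add, mul_smul, hp, ← mul_smul, hcomm, mul_smul, hq, map_mul, mul_smul]

lemma exists_eigen [IsAlgClosed k] (n : ℕ) : ∀ (p : k[X]) (v : M), p.natDegree ≤ n → p ≠ 0 →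
    v ≠ 0 → aeval (Xg k) p • v = 0 →
    ∃ (c : k) (w : M), w ≠ 0 ∧ Xg k • w = algebraMap k (R k) c • w := by
  induction n with
  | zero =>
    intro p v hp hp0 hv h
    exfalso
    apply hp0
    rw [Polynomial.eq_C_of_natDegree_le_zero hp, aeval_C] at h
    rw [Polynomial.eq_C_of_natDegree_le_zero hp, scalar_zero k v hv _ h, C_0]
  | succ n ih =>
    intro p v hp hp0 hv h
    by_cases hd : p.natDegree ≤ n
    · exact ih p v hd hp0 hv h
    · obtain ⟨c, hc⟩ := IsAlgClosed.exists_root p (by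
        intro h0
        have : p.natDegree = 0 := Polynomial.natDegree_eq_of_degree_eq_some h0
        omega)
      obtain ⟨q, rfl⟩ := Polynomial.dvd_iff_isRoot.mpr hc
      have hq0 : q ≠ 0 := right_ne_zero_of_mul hp0
      rw [Polynomial.natDegree_mul (Polynomial.X_sub_C_ne_zero c) hq0,
        Polynomial.natDegree_X_sub_C] at hp
      by_cases hz : aeval (Xg k) q • v = 0
      · exact ih q v (by omega) hq0 hv hz
      · refine ⟨c, _, hz, ?_⟩
        rw [map_mul, mul_smul, map_sub, aeval_X, aeval_C, sub_smul] at h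
        exact sub_eq_zero.mp h

lemma eigen_stable (c : k) (w : M) (hw : w ≠ 0) (h : Xg k • w = algebraMap k (R k) c • w)
    (r : R k) : ∃ d : k, r • w = algebraMap k (R k) d • w := by
  have hy : w = algebraMap k (R k) c • Yg k • w := by
    rw [← mul_smul, Algebra.commutes, mul_smul, ← h, ← mul_smul, yx_one, one_smul]
  have hc : c ≠ 0 := by
    rintro rfl
    apply hw
    rw [hy, map_zero, zero_smul]
  induction r using R_induction with
  | hc d => exact ⟨d, rfl⟩
  | hx => exact ⟨c, h⟩
  | hy =>
    refine ⟨c⁻¹, ?_⟩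
    conv_rhs => rw [hy]
    rw [← mul_smul, ← map_mul, inv_mul_cancel₀ hc, map_one, one_smul]
  | hadd a b ha hb =>
    obtain ⟨d, hd⟩ := ha
    obtain ⟨d', hd'⟩ := hb
    exact ⟨d + d', by rw [map_add, add_smul, add_smul, hd, hd']⟩
  | hmul a b ha hb =>
    obtain ⟨d, hd⟩ := ha
    obtain ⟨d', hd'⟩ := hb
    exact ⟨d' * d, by
      rw [mul_smul, hd', ← mul_smul, ← Algebra.commutes, mul_smul, hd, map_mul, mul_smul]⟩

lemma exists_smul_eq (hV : IsSimpleModule (R k) M) (v w : M) (hv : v ≠ 0) :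
    ∃ r : R k, r • v = w := by
  obtain ⟨r, hr⟩ := IsSimpleModule.toSpanSingleton_surjective (R k) hv w
  exact ⟨r, hr⟩

lemma finite_of_xy [IsAlgClosed k] [Module k M] [IsScalarTower k (R k) M]
    (hV : IsSimpleModule (R k) M) (hxy : ∀ v : M, Xg k • Yg k • v = v) : Module.Finite k M := by
  have heig : ∃ (c : k) (w : M), w ≠ 0 ∧ Xg k • w = algebraMap k (R k) c • w := by
    have : Nontrivial M := IsSimpleModule.nontrivial (R k) M
    obtain ⟨v, hv⟩ := exists_ne (0 : M)
    by_cases h1 : aeval (Xg k) (X - C 1 : k[X]) • v = 0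
    · exact exists_eigen k _ _ v le_rfl (Polynomial.X_sub_C_ne_zero 1) hv h1
    · obtain ⟨r, hr⟩ := exists_smul_eq k hV _ v h1
      obtain ⟨n, p, hp⟩ := laurent k hxy r
      have h2 := hp (aeval (Xg k) (X - C 1 : k[X]) • v)
      rw [hr] at h2
      refine exists_eigen k _ (X ^ n - p * (X - C 1)) v le_rfl ?_ hv ?_
      · intro h3
        have := congrArg (Polynomial.eval 1) h3
        simp at this
      · rw [map_sub, map_mul, map_pow, aeval_X, sub_smul, mul_smul, h2, sub_self]
  obtain ⟨c, w, hw, h⟩ := heig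
  refine ⟨⟨{w}, ?_⟩⟩
  rw [eq_top_iff]
  rintro z -
  obtain ⟨r, rfl⟩ := exists_smul_eq k hV w z hw
  obtain ⟨d, hd⟩ := eigen_stable k c w hw h r
  rw [hd, algebraMap_smul]
  exact Submodule.smul_mem _ _ (Submodule.subset_span (by simp))

end

/-- a short exact sequence `0 → U → E → V → 0` of left `R`-modules with
`U`, `V` simple and `V` infinite-dimensional over `k` always splits: there is an
`R`-linear section of `E → V`, `E ≅ U ⊕ V`, and the image of `U` is a direct summand. -/
theorem ses_splits_of_infinite_dim_quotient (k : Type) [Field k] [IsAlgClosed k] [CharZero k]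
    (U E V : Type) [AddCommGroup U] [Module (R k) U] [AddCommGroup E] [Module (R k) E]
    [AddCommGroup V] [Module (R k) V] [Module k V] [IsScalarTower k (R k) V]
    (f : U →ₗ[R k] E) (g : E →ₗ[R k] V)
    (hf : Function.Injective f) (hg : Function.Surjective g)
    (hexact : LinearMap.range f = LinearMap.ker g)
    (hU : IsSimpleModule (R k) U) (hV : IsSimpleModule (R k) V)
    (hdim : ¬ Module.Finite k V) :
    (∃ h : V →ₗ[R k] E, g ∘ₗ h = LinearMap.id) ∧
    Nonempty (E ≃ₗ[R k] U × V) ∧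
    (∃ N : Submodule (R k) E, IsCompl (LinearMap.range f) N) := by
  have hex : ∃ v : V, Xg k • Yg k • v ≠ v := by
    by_contra! hcon
    exact hdim (finite_of_xy k hV hcon)
  obtain ⟨v, hv⟩ := hex
  obtain ⟨w, rfl⟩ := hg v
  set w0 : E := w - Xg k • Yg k • w with hw0
  have hyw : Yg k • w0 = 0 := by
    rw [hw0, smul_sub, ← mul_smul (Yg k) (Xg k), yx_one, one_smul, sub_self]
  have hgw : g w0 ≠ 0 := by
    rw [hw0, map_sub, map_smul, map_smul]
    exact fun h => hv (sub_eq_zero.mp h).symm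
  have hyg : Yg k • g w0 = 0 := by rw [← map_smul, hyw, map_zero]
  let N : Submodule (R k) E := Submodule.span (R k) {w0}
  have hinj : ∀ z ∈ N, g z = 0 → z = 0 := by
    intro z hz hgz
    obtain ⟨r, rfl⟩ := Submodule.mem_span_singleton.mp hz
    obtain ⟨q, hq⟩ := cyc_poly k w0 hyw r 1
    rw [map_one, one_smul] at hq
    rw [hq, map_smul] at hgz
    rw [hq, poly_indep k (g w0) hyg hgw _ q le_rfl hgz, map_zero, zero_smul]
  have hbij : Function.Bijective (g.domRestrict N) := by
    constructor
    · rw [injective_iff_map_eq_zero]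
      intro z hz
      exact Subtype.ext (hinj z.1 z.2 hz)
    · intro z
      obtain ⟨r, hr⟩ := exists_smul_eq k hV _ z hgw
      exact ⟨⟨r • w0, Submodule.mem_span_singleton.mpr ⟨r, rfl⟩⟩, by
        rw [← hr, ← map_smul]; rfl⟩
  let e : N ≃ₗ[R k] V := LinearEquiv.ofBijective _ hbij
  have hcompl : IsCompl (LinearMap.range f) N := by
    rw [hexact]
    constructor
    · rw [Submodule.disjoint_def]
      intro z hz hzN
      exact hinj z hzN hz
    · rw [codisjoint_iff, eq_top_iff]
      rintro z -
      have he : g (e.symm (g z) : E) = g z := e.apply_symm_apply (g z)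
      rw [← sub_add_cancel z (e.symm (g z) : E)]
      refine Submodule.add_mem_sup ?_ (e.symm (g z)).2
      rw [LinearMap.mem_ker, map_sub, he, sub_self]
  refine ⟨⟨N.subtype ∘ₗ e.symm.toLinearMap, ?_⟩, ⟨?_⟩, ⟨N, hcompl⟩⟩
  · ext z
    exact e.apply_symm_apply z
  · exact (Submodule.prodEquivOfIsCompl _ _ hcompl).symm.trans
      ((LinearEquiv.ofInjective f hf).symm.prodCongr e)
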